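/- Fix r ≥ 2 and δ = 1/(5r²). For all sufficiently large t, there exists an r-uniform hypergraph F* on t vertices with girth at least r+2 (no cycle of length ≤ r+1, where a 2-cycle is two edges sharing ≥ 2 vertices and an ℓ-cycle for ℓ > 2 is a loose cycle) such that for every vertex subset S with t^{1−δ} < |S| = s < t, the number of edges of F* having exactly r−1 vertices in S (and one vertex outside S) is at least (1/10)·C(s, r−1)·(t−s)·t^{1−r+1/(2r)}. -/

import Mathlib

/-- `e, v` form a loose cycle of length `ℓ` in the hypergraph `E`. -/
def IsLooseCycle {V : Type} [DecidableEq V] (E : Finset (Finset V)) (ℓ : ℕ)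
    (e : ZMod ℓ → Finset V) (v : ZMod ℓ → V) : Prop :=
  Function.Injective e ∧ Function.Injective v ∧ (∀ i, e i ∈ E) ∧
    (∀ i, e i ∩ e (i + 1) = {v (i + 1)}) ∧
    (∀ i j, j ≠ i → j ≠ i + 1 → i ≠ j + 1 → e i ∩ e j = ∅)

open Finset in
/-- Expectation of `f` over the random subset of `R` containing each element independently with
probability `p`. -/
noncomputable def binomialMean {α : Type*} [DecidableEq α] (R : Finset α) (p : ℝ)
    (f : Finset α → ℝ) : ℝ :=
  ∑ H ∈ R.powerset, p ^ #H * (1 - p) ^ #(R \ H) * f H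

open Finset in
open scoped Classical in
/-- The subfamilies of `𝒞` whose members are pairwise disjoint. -/
noncomputable def disjointSubfamilies {α : Type*} (𝒞 : Finset (Finset α)) :
    Finset (Finset (Finset α)) :=
  𝒞.powerset.filter fun 𝒟 : Finset (Finset α) => (𝒟 : Set (Finset α)).PairwiseDisjoint id

lemma mem_disjointSubfamilies {α : Type*} {𝒞 𝒟 : Finset (Finset α)} :
    𝒟 ∈ disjointSubfamilies 𝒞 ↔ 𝒟 ⊆ 𝒞 ∧ (𝒟 : Set (Finset α)).PairwiseDisjoint id := by
  simp [disjointSubfamilies]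

namespace binomialMean

open Finset

variable {α : Type*} [DecidableEq α] {R : Finset α} {p : ℝ}

lemma mono (hp₀ : 0 ≤ p) (hp₁ : p ≤ 1) {f g : Finset α → ℝ}
    (h : ∀ H ⊆ R, f H ≤ g H) : binomialMean R p f ≤ binomialMean R p g := by
  have : 0 ≤ 1 - p := sub_nonneg.2 hp₁
  exact sum_le_sum fun H hH => mul_le_mul_of_nonneg_left (h H (mem_powerset.1 hH)) (by positivity)

lemma sum {ι : Type*} (I : Finset ι) (f : ι → Finset α → ℝ) :
    binomialMean R p (fun H => ∑ i ∈ I, f i H) = ∑ i ∈ I, binomialMean R p (f i) := by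
  simp only [binomialMean, mul_sum]
  exact sum_comm

lemma add (f g : Finset α → ℝ) :
    binomialMean R p (fun H => f H + g H) = binomialMean R p f + binomialMean R p g := by
  simp only [binomialMean, mul_add, sum_add_distrib]

lemma const_mul (c : ℝ) (f : Finset α → ℝ) :
    binomialMean R p (fun H => c * f H) = c * binomialMean R p f := by
  simp only [binomialMean, mul_sum]
  exact sum_congr rfl fun H _ => by ring

lemma prod (u v : α → ℝ) :
    binomialMean R p (fun H => (∏ a ∈ H, u a) * ∏ a ∈ R \ H, v a) =
      ∏ a ∈ R, (p * u a + (1 - p) * v a) := by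
  rw [prod_add, binomialMean]
  refine sum_congr rfl fun H _ => ?_
  simp only [prod_mul_distrib, prod_const]
  ring

lemma one : binomialMean R p (fun _ => 1) = 1 := by
  simpa using prod (R := R) (p := p) (fun _ => 1) (fun _ => 1)

lemma exp_neg_card_inter_le (hp₀ : 0 ≤ p) (hp₁ : p ≤ 1) {Q : Finset α} (hQ : Q ⊆ R) :
    binomialMean R p (fun H => Real.exp (-#(H ∩ Q))) ≤ Real.exp (-(p * #Q / 2)) := by
  have h := prod (R := R) (p := p) (fun a => if a ∈ Q then Real.exp (-1) else 1) (fun _ => 1)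
  have h₁ : (fun H : Finset α => Real.exp (-(#(H ∩ Q) : ℝ))) =
      fun H => (∏ a ∈ H, if a ∈ Q then Real.exp (-1) else 1) * ∏ a ∈ R \ H, (1 : ℝ) := by
    funext H
    rw [prod_ite_mem, prod_const, ← Real.exp_nat_mul]
    simp
  have h₂ : Real.exp (-(p * #Q / 2)) =
      ∏ a ∈ R, if a ∈ Q then Real.exp (-(p / 2)) else 1 := by
    rw [prod_ite_mem, prod_const, ← Real.exp_nat_mul, inter_eq_right.2 hQ]
    congr 1
    ring
  rw [h₁, h, h₂]
  have h₃ : Real.exp (-1) ≤ 1 / 2 := by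
    rw [Real.exp_neg, inv_eq_one_div]
    exact one_div_le_one_div_of_le (by norm_num) (by linarith [Real.add_one_le_exp (1 : ℝ)])
  have h₄ := Real.exp_pos (-1)
  refine prod_le_prod (fun a _ => ?_) fun a _ => ?_
  · have : 0 ≤ 1 - p := sub_nonneg.2 hp₁
    split_ifs <;> positivity
  · split_ifs
    · have := Real.add_one_le_exp (-(p / 2))
      nlinarith
    · linarith

lemma indicator_subset {A : Finset α} (hA : A ⊆ R) :
    binomialMean R p (fun H => if A ⊆ H then 1 else 0) = p ^ #A := by
  have h := prod (R := R) (p := p) (fun _ => 1) (fun a => if a ∈ A then 0 else 1)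
  have h₁ : ∏ a ∈ R, (p * 1 + (1 - p) * if a ∈ A then 0 else 1) =
      ∏ a ∈ R, if a ∈ A then p else 1 :=
    prod_congr rfl fun a _ => by split_ifs <;> ring
  rw [h₁, prod_ite_mem, prod_const, inter_eq_right.2 hA] at h
  rw [← h]
  unfold binomialMean
  refine sum_congr rfl fun H _ => ?_
  congr 1
  beta_reduce
  by_cases hAH : A ⊆ H
  · rw [if_pos hAH, prod_const_one, one_mul]
    exact (prod_eq_one fun a ha => if_neg fun h' => (mem_sdiff.1 ha).2 (hAH h')).symm
  · obtain ⟨a, haA, haH⟩ := not_subset.1 hAH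
    have h₀ : ∏ a ∈ R \ H, (if a ∈ A then (0 : ℝ) else 1) = 0 :=
      prod_eq_zero (mem_sdiff.2 ⟨hA haA, haH⟩) (if_pos haA)
    rw [if_neg hAH, h₀, mul_zero]

/-- The exponential generating function of pairwise disjoint subfamilies of `𝒞` lying inside the
random set. -/
lemma sum_disjoint_subfamilies_le (hp₀ : 0 ≤ p) (𝒞 : Finset (Finset α))
    (h𝒞 : ∀ C ∈ 𝒞, C ⊆ R) (y : ℝ) (hy : 0 ≤ y) :
    binomialMean R p (fun H => ∑ 𝒟 ∈ disjointSubfamilies 𝒞,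
        y ^ #𝒟 * if 𝒟.biUnion id ⊆ H then 1 else 0) ≤
      Real.exp (y * ∑ C ∈ 𝒞, p ^ #C) := by
  rw [sum]
  calc
    _ = ∑ 𝒟 ∈ disjointSubfamilies 𝒞,
        ∏ C ∈ 𝒟, y * p ^ #C := by
      refine sum_congr rfl fun 𝒟 h𝒟 => ?_
      rw [mem_disjointSubfamilies] at h𝒟
      have hsub : 𝒟.biUnion id ⊆ R := biUnion_subset.2 fun C hC => h𝒞 C (h𝒟.1 hC)
      rw [const_mul, indicator_subset hsub, card_biUnion h𝒟.2, prod_mul_distrib, prod_const,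
        prod_pow_eq_pow_sum]
      rfl
    _ ≤ ∑ 𝒟 ∈ 𝒞.powerset, ∏ C ∈ 𝒟, y * p ^ #C :=
      sum_le_sum_of_subset_of_nonneg
        (fun 𝒟 h𝒟 => mem_powerset.2 (mem_disjointSubfamilies.1 h𝒟).1) fun 𝒟 _ _ =>
        prod_nonneg fun C _ => by positivity
    _ = ∏ C ∈ 𝒞, (1 + y * p ^ #C) := (prod_one_add _).symm
    _ ≤ ∏ C ∈ 𝒞, Real.exp (y * p ^ #C) :=
      prod_le_prod (fun C _ => by positivity) fun C _ => by
        linarith [Real.add_one_le_exp (y * p ^ #C)]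
    _ = Real.exp (y * ∑ C ∈ 𝒞, p ^ #C) := by rw [← Real.exp_sum, mul_sum]

end binomialMean

open Finset in
/-- If the total failure weight is less than one, some subset of `R` meets every `Q i` in more than
`a i` elements and contains no `k i` pairwise disjoint members of `𝒞 i`. -/
lemma exists_subset_forall_inter_large_and_disjoint_small {α ι : Type*} [DecidableEq α]
    {R : Finset α} {p : ℝ} (hp₀ : 0 ≤ p) (hp₁ : p ≤ 1) (I : Finset ι) (Q : ι → Finset α)
    (hQ : ∀ i ∈ I, Q i ⊆ R) (𝒞 : ι → Finset (Finset α)) (h𝒞 : ∀ i ∈ I, ∀ C ∈ 𝒞 i, C ⊆ R)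
    (a k : ι → ℝ)
    (hlt : ∑ i ∈ I, (Real.exp (a i - p * #(Q i) / 2) +
      Real.exp (Real.exp 1 * ∑ C ∈ 𝒞 i, p ^ #C - k i)) < 1) :
    ∃ H ⊆ R, ∀ i ∈ I, a i < #(H ∩ Q i) ∧
      ∀ 𝒟 ⊆ 𝒞 i, (𝒟 : Set (Finset α)).PairwiseDisjoint id → (∀ C ∈ 𝒟, C ⊆ H) → #𝒟 < k i := by
  by_contra! hcon
  refine hlt.not_ge ?_
  set F : ι → Finset α → ℝ := fun i H => Real.exp (a i) * Real.exp (-#(H ∩ Q i)) +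
    Real.exp (-k i) * ∑ 𝒟 ∈ disjointSubfamilies (𝒞 i),
        Real.exp 1 ^ #𝒟 * if 𝒟.biUnion id ⊆ H then 1 else 0 with hF
  have hsum_nonneg : ∀ (H : Finset α) (𝒟 : Finset (Finset α)),
      0 ≤ Real.exp 1 ^ #𝒟 * if 𝒟.biUnion id ⊆ H then (1 : ℝ) else 0 := by
    intro H 𝒟
    split_ifs <;> positivity
  have hFnonneg : ∀ i H, 0 ≤ F i H := fun i H =>
    add_nonneg (by positivity)
      (mul_nonneg (Real.exp_pos _).le (sum_nonneg fun 𝒟 _ => hsum_nonneg H 𝒟))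
  calc
    (1 : ℝ) = binomialMean R p (fun _ => 1) := binomialMean.one.symm
    _ ≤ binomialMean R p (fun H => ∑ i ∈ I, F i H) := by
      refine binomialMean.mono hp₀ hp₁ fun H hH => ?_
      obtain ⟨i, hi, hbad⟩ := hcon H hH
      refine le_trans ?_ (single_le_sum (fun i _ => hFnonneg i H) hi)
      by_cases hai : a i < #(H ∩ Q i)
      · obtain ⟨𝒟, h𝒟, hdisj, hsub, hk⟩ := hbad hai
        have h₁ : (1 : ℝ) ≤ Real.exp (-k i) *
            (Real.exp 1 ^ #𝒟 * if 𝒟.biUnion id ⊆ H then 1 else 0) := by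
          have hsub' : 𝒟.biUnion id ⊆ H := biUnion_subset.2 hsub
          rw [if_pos hsub', mul_one, ← Real.exp_nat_mul, ← Real.exp_add]
          exact Real.one_le_exp (by linarith)
        refine h₁.trans ((mul_le_mul_of_nonneg_left ?_ (Real.exp_pos _).le).trans
          (le_add_of_nonneg_left (by positivity)))
        exact single_le_sum (f := fun 𝒟 : Finset (Finset α) =>
          Real.exp 1 ^ #𝒟 * if 𝒟.biUnion id ⊆ H then (1 : ℝ) else 0)
          (fun 𝒟 _ => hsum_nonneg H 𝒟) (mem_disjointSubfamilies.2 ⟨h𝒟, hdisj⟩)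
      · refine le_trans ?_ (le_add_of_nonneg_right
          (mul_nonneg (Real.exp_pos _).le (sum_nonneg fun 𝒟 _ => hsum_nonneg H 𝒟)))
        rw [← Real.exp_add]
        exact Real.one_le_exp (by linarith [not_lt.1 hai])
    _ = ∑ i ∈ I, binomialMean R p (F i) := binomialMean.sum _ _
    _ ≤ _ := by
      refine sum_le_sum fun i hi => ?_
      rw [hF, binomialMean.add, binomialMean.const_mul, binomialMean.const_mul]
      refine add_le_add ?_ ?_
      · rw [sub_eq_add_neg, Real.exp_add]
        exact mul_le_mul_of_nonneg_left (binomialMean.exp_neg_card_inter_le hp₀ hp₁ (hQ i hi))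
          (Real.exp_pos _).le
      · rw [sub_eq_neg_add, Real.exp_add]
        exact mul_le_mul_of_nonneg_left (binomialMean.sum_disjoint_subfamilies_le hp₀ _ (h𝒞 i hi)
          _ (Real.exp_pos _).le) (Real.exp_pos _).le

open Finset in
/-- Deleting the edges of a maximal disjoint subfamily destroys every member of `𝒞`. -/
lemma exists_disjoint_subfamily_forall_not_subset_sdiff {α : Type*} [DecidableEq α]
    (𝒞 : Finset (Finset α)) (hne : ∀ C ∈ 𝒞, C.Nonempty) (H : Finset α) :
    ∃ 𝒟 ⊆ 𝒞, (𝒟 : Set (Finset α)).PairwiseDisjoint id ∧ (∀ C ∈ 𝒟, C ⊆ H) ∧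
      ∀ C ∈ 𝒞, ¬ C ⊆ H \ 𝒟.biUnion id := by
  obtain ⟨𝒟, h𝒟, hmax⟩ := exists_max_image (disjointSubfamilies (𝒞.filter (· ⊆ H))) card
    ⟨∅, mem_disjointSubfamilies.2 (by simp)⟩
  rw [mem_disjointSubfamilies] at h𝒟
  refine ⟨𝒟, h𝒟.1.trans (filter_subset _ _), h𝒟.2, fun C hC => (mem_filter.1 (h𝒟.1 hC)).2,
    fun C hC hCH => ?_⟩
  have hdisj : ∀ D ∈ 𝒟, Disjoint C D := fun D hD =>
    disjoint_of_subset_left hCH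
      (disjoint_sdiff_self_left.mono_right (subset_biUnion_of_mem id hD))
  have hC𝒟 : C ∉ 𝒟 := fun h => (hne C hC).ne_empty (disjoint_self.1 (hdisj C h))
  have := hmax (insert C 𝒟) (mem_disjointSubfamilies.2 ⟨?_, ?_⟩)
  · rw [card_insert_of_notMem hC𝒟] at this
    omega
  · exact insert_subset (mem_filter.2 ⟨hC, hCH.trans sdiff_subset⟩) h𝒟.1
  · rw [coe_insert]
    exact h𝒟.2.insert fun D hD _ => hdisj D hD

open Finset in
/-- Families of at least two and at most `r + 1` edges that span no more vertices than a loose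
cycle with the same number of edges. -/
def tightFamilies (r t : ℕ) : Finset (Finset (Finset (Fin t))) :=
  (powersetCard r univ).powerset.filter fun C =>
    2 ≤ #C ∧ #C ≤ r + 1 ∧ #(C.biUnion id) ≤ #C * (r - 1)

section Girth

open Finset

variable {r t : ℕ} {E : Finset (Finset (Fin t))}

lemma card_inter_le_one_of_tightFamilies_free (hr : 2 ≤ r) (hE : ∀ e ∈ E, #e = r)
    (hfree : ∀ C ∈ tightFamilies r t, ¬ C ⊆ E) :
    ∀ e ∈ E, ∀ f ∈ E, e ≠ f → #(e ∩ f) ≤ 1 := by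
  intro e he f hf hef
  by_contra! hcard
  have hsub : ({e, f} : Finset (Finset (Fin t))) ⊆ E := by
    simp [insert_subset_iff, he, hf]
  refine hfree {e, f} (mem_filter.2 ⟨mem_powerset.2 fun g hg =>
    mem_powersetCard.2 ⟨subset_univ _, hE g (hsub hg)⟩, ?_⟩) hsub
  have hunion : #(e ∪ f) + #(e ∩ f) = r + r := by
    rw [card_union_add_card_inter, hE e he, hE f hf]
  rw [card_pair hef, biUnion_insert, singleton_biUnion]
  refine ⟨le_rfl, by omega, ?_⟩
  change #(e ∪ f) ≤ _
  omega

lemma not_isLooseCycle_of_tightFamilies_free (hE : ∀ e ∈ E, #e = r)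
    (hfree : ∀ C ∈ tightFamilies r t, ¬ C ⊆ E) {ℓ : ℕ} (hℓ : 3 ≤ ℓ) (hℓr : ℓ ≤ r + 1)
    (e : ZMod ℓ → Finset (Fin t)) (v : ZMod ℓ → Fin t) : ¬ IsLooseCycle E ℓ e v := by
  rintro ⟨heinj, hvinj, hmem, hinter, -⟩
  have : NeZero ℓ := ⟨by omega⟩
  have : Fact (1 < ℓ) := ⟨by omega⟩
  have hsub : univ.image e ⊆ E := by
    simp [image_subset_iff, hmem]
  have hcard : #(univ.image e) = ℓ := by
    rw [card_image_of_injective _ heinj, card_univ, ZMod.card]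
  refine hfree (univ.image e) (mem_filter.2 ⟨mem_powerset.2 fun g hg =>
    mem_powersetCard.2 ⟨subset_univ _, hE g (hsub hg)⟩, ?_⟩) hsub
  rw [hcard]
  refine ⟨by omega, hℓr, ?_⟩
  have hv : ∀ i, v (i + 1) ∈ e i ∩ e (i + 1) := fun i => by simp [hinter]
  have hcover : (univ.image e).biUnion id ⊆ univ.biUnion fun i => (e i).erase (v (i + 1)) := by
    intro x hx
    simp only [mem_biUnion, mem_image, mem_univ, true_and, exists_exists_eq_and, id] at hx
    obtain ⟨i, hi⟩ := hx
    simp only [mem_biUnion, mem_univ, true_and, mem_erase]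
    by_cases hxi : x = v (i + 1)
    · refine ⟨i + 1, ?_, hxi ▸ (mem_inter.1 (hv i)).2⟩
      rw [hxi]
      exact fun h => by simpa using hvinj h
    · exact ⟨i, hxi, hi⟩
  calc
    #((univ.image e).biUnion id) ≤ #(univ.biUnion fun i => (e i).erase (v (i + 1))) :=
      card_le_card hcover
    _ ≤ #(univ : Finset (ZMod ℓ)) * (r - 1) := card_biUnion_le_card_mul _ _ _ fun i _ => by
      rw [card_erase_of_mem (mem_inter.1 (hv i)).1, hE _ (hmem i)]
    _ = ℓ * (r - 1) := by rw [card_univ, ZMod.card]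

end Girth

section Counting

open Finset

variable {r t : ℕ}

/-- A set of at most `n` elements of `Fin t` is contained in the range of a function on `Fin n`. -/
lemma exists_subset_image_fin_of_card_le {n : ℕ} {D : Finset (Fin t)} (ht : 0 < t) (hD : #D ≤ n) :
    ∃ g : Fin n → Fin t, D ⊆ univ.image g := by
  refine ⟨fun i => if h : (i : ℕ) < #D then D.equivFin.symm ⟨i, h⟩ else ⟨0, ht⟩, fun x hx => ?_⟩
  rw [mem_image]
  refine ⟨⟨D.equivFin ⟨x, hx⟩, (D.equivFin ⟨x, hx⟩).2.trans_le hD⟩, mem_univ _, ?_⟩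
  simp

lemma card_tightFamilies_filter_le (ht : 0 < t) {e : Finset (Fin t)} {ℓ n : ℕ}
    (hn : n + r = ℓ * (r - 1)) :
    #((tightFamilies r t).filter fun C => e ∈ C ∧ #C = ℓ) ≤ t ^ n * 2 ^ 2 ^ (r + n) := by
  have hsub : ((tightFamilies r t).filter fun C => e ∈ C ∧ #C = ℓ) ⊆
      (univ.filter fun _ : Fin n → Fin t => #e = r).biUnion
        fun g => (e ∪ univ.image g).powerset.powerset := by
    intro C hC
    simp only [tightFamilies, mem_filter, mem_powerset] at hC
    obtain ⟨⟨hCr, -, -, hCcard⟩, heC, rfl⟩ := hC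
    have her : #e = r := (mem_powersetCard.1 (hCr heC)).2
    have heU : e ⊆ C.biUnion id := subset_biUnion_of_mem id heC
    obtain ⟨g, hg⟩ := exists_subset_image_fin_of_card_le (n := n) (D := C.biUnion id \ e) ht (by
      rw [card_sdiff_of_subset heU]
      omega)
    refine mem_biUnion.2 ⟨g, by simp [her], mem_powerset.2 fun f hf => mem_powerset.2 ?_⟩
    exact (subset_biUnion_of_mem id hf).trans (sdiff_le_iff.1 hg)
  refine (card_le_card hsub).trans ((card_biUnion_le_card_mul _ _ (2 ^ 2 ^ (r + n)) ?_).trans ?_)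
  · intro g hg
    rw [card_powerset, card_powerset]
    refine Nat.pow_le_pow_right (by norm_num) (Nat.pow_le_pow_right (by norm_num) ?_)
    refine (card_union_le _ _).trans (add_le_add (mem_filter.1 hg).2.le ?_)
    exact card_image_le.trans (by simp)
  · refine Nat.mul_le_mul_right _ ((card_filter_le _ _).trans ?_)
    simp

/-- The expected number of tight families through a given `r`-set, with edge probability
`q / t ^ (r - 1)`. -/
lemma sum_tightFamilies_filter_mem_le (hr : 2 ≤ r) (ht : 0 < t) {q : ℝ} (hq : 1 ≤ q)
    (e : Finset (Fin t)) :
    ∑ C ∈ (tightFamilies r t).filter (e ∈ ·), (q / t ^ (r - 1)) ^ #C ≤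
      r * 2 ^ 2 ^ (r + (r + 1) * (r - 1)) * (q / t ^ (r - 1)) * (q ^ r / t) := by
  have ht' : (0 : ℝ) < t := by exact_mod_cast ht
  set p : ℝ := q / t ^ (r - 1) with hp
  have hmaps : ∀ C ∈ (tightFamilies r t).filter (e ∈ ·), #C ∈ Icc 2 (r + 1) := by
    intro C hC
    simp only [tightFamilies, mem_filter] at hC
    exact mem_Icc.2 ⟨hC.1.2.1, hC.1.2.2.1⟩
  rw [← sum_fiberwise_of_maps_to hmaps]
  have hterm : ∀ ℓ ∈ Icc 2 (r + 1),
      ∑ C ∈ ((tightFamilies r t).filter (e ∈ ·)).filter (#· = ℓ), p ^ #C ≤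
        2 ^ 2 ^ (r + (r + 1) * (r - 1)) * p * (q ^ r / t) := by
    intro ℓ hℓ
    rw [mem_Icc] at hℓ
    obtain ⟨n, hn⟩ : ∃ n, n + r = ℓ * (r - 1) := by
      refine ⟨ℓ * (r - 1) - r, Nat.sub_add_cancel ?_⟩
      have := Nat.mul_le_mul_right (r - 1) hℓ.1
      omega
    have hnr : n ≤ (r + 1) * (r - 1) := by
      have := Nat.mul_le_mul_right (r - 1) hℓ.2
      omega
    have hconst : ∑ C ∈ ((tightFamilies r t).filter (e ∈ ·)).filter (#· = ℓ), p ^ #C =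
        #((tightFamilies r t).filter fun C => e ∈ C ∧ #C = ℓ) * p ^ ℓ := by
      rw [filter_filter, ← nsmul_eq_mul, ← sum_const]
      exact sum_congr rfl fun C hC => by rw [(mem_filter.1 hC).2.2]
    have hpow : (t : ℝ) ^ n * p ^ ℓ = q ^ ℓ / t ^ r := by
      rw [hp, div_pow, ← pow_mul, mul_comm (r - 1) ℓ, ← hn, pow_add]
      field_simp
    have hpq : p * (q ^ r / t) = q ^ (r + 1) / t ^ r := by
      obtain ⟨m, rfl⟩ : ∃ m, r = m + 1 := ⟨r - 1, by omega⟩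
      rw [hp, Nat.add_sub_cancel]
      field_simp
      ring
    have hp₀ : 0 ≤ p := by positivity
    calc
      _ = #((tightFamilies r t).filter fun C => e ∈ C ∧ #C = ℓ) * p ^ ℓ := hconst
      _ ≤ ((t ^ n * 2 ^ 2 ^ (r + n) : ℕ) : ℝ) * p ^ ℓ := by
        gcongr
        exact card_tightFamilies_filter_le ht hn
      _ = 2 ^ 2 ^ (r + n) * (q ^ ℓ / t ^ r) := by
        rw [← hpow]
        push_cast
        ring
      _ ≤ 2 ^ 2 ^ (r + (r + 1) * (r - 1)) * (q ^ (r + 1) / t ^ r) := by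
        have h₁ : q ^ ℓ ≤ q ^ (r + 1) := pow_le_pow_right₀ hq hℓ.2
        have h₂ : (2 : ℝ) ^ 2 ^ (r + n) ≤ 2 ^ 2 ^ (r + (r + 1) * (r - 1)) := by
          refine pow_le_pow_right₀ (by norm_num) (Nat.pow_le_pow_right (by norm_num) (by omega))
        gcongr
      _ = _ := by rw [mul_assoc, hpq]
  calc
    _ ≤ ∑ ℓ ∈ Icc 2 (r + 1), 2 ^ 2 ^ (r + (r + 1) * (r - 1)) * p * (q ^ r / t) :=
      sum_le_sum hterm
    _ = _ := by
      rw [sum_const, Nat.card_Icc, nsmul_eq_mul]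
      have : r + 1 + 1 - 2 = r := by omega
      rw [this]
      ring

/-- The `r`-sets having exactly one vertex outside `S`. -/
def crossingSets (r : ℕ) {t : ℕ} (S : Finset (Fin t)) : Finset (Finset (Fin t)) :=
  (powersetCard r univ).filter fun e => #(e ∩ S) = r - 1

lemma choose_mul_le_card_crossingSets (hr : 2 ≤ r) (S : Finset (Fin t)) :
    (#S).choose (r - 1) * (t - #S) ≤ #(crossingSets r S) := by
  have hcard : #(powersetCard (r - 1) S ×ˢ Sᶜ) = (#S).choose (r - 1) * (t - #S) := by
    rw [card_product, card_powersetCard, card_compl, Fintype.card_fin]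
  rw [← hcard]
  have hinter : ∀ x ∈ powersetCard (r - 1) S ×ˢ Sᶜ, insert x.2 x.1 ∩ S = x.1 := by
    rintro ⟨A, x⟩ h
    simp only [mem_product, mem_powersetCard, mem_compl] at h
    rw [insert_inter_of_notMem h.2, inter_eq_left.2 h.1.1]
  have hsdiff : ∀ x ∈ powersetCard (r - 1) S ×ˢ Sᶜ, insert x.2 x.1 \ S = {x.2} := by
    rintro ⟨A, x⟩ h
    simp only [mem_product, mem_powersetCard, mem_compl] at h
    rw [insert_sdiff_of_notMem _ h.2, sdiff_eq_empty_iff_subset.2 h.1.1, insert_empty]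
  refine card_le_card_of_injOn (fun x => insert x.2 x.1) (fun x hx => ?_) fun x hx y hy hxy => ?_
  · have hi := hinter x hx
    simp only [mem_coe, mem_product, mem_powersetCard, mem_compl] at hx
    simp only [crossingSets, mem_coe, mem_filter, mem_powersetCard, subset_univ, true_and]
    refine ⟨?_, by rw [hi, hx.1.2]⟩
    rw [card_insert_of_notMem fun h => hx.2 (hx.1.1 h), hx.1.2]
    omega
  · have hxy' : insert x.2 x.1 = insert y.2 y.1 := hxy
    have h₁ : x.1 = y.1 := by rw [← hinter x hx, ← hinter y hy, hxy']
    have h₂ : ({x.2} : Finset (Fin t)) = {y.2} := by rw [← hsdiff x hx, ← hsdiff y hy, hxy']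
    exact Prod.ext h₁ (singleton_injective h₂)

/-- The tight families containing a member of `Q`. -/
def tightFamiliesMeeting (r : ℕ) {t : ℕ} (Q : Finset (Finset (Fin t))) :
    Finset (Finset (Finset (Fin t))) :=
  (tightFamilies r t).filter fun C => (C ∩ Q).Nonempty

lemma sum_tightFamiliesMeeting_le (hr : 2 ≤ r) (ht : 0 < t) {q : ℝ} (hq : 1 ≤ q)
    (Q : Finset (Finset (Fin t))) :
    ∑ C ∈ tightFamiliesMeeting r Q, (q / t ^ (r - 1)) ^ #C ≤
      r * 2 ^ 2 ^ (r + (r + 1) * (r - 1)) * (q ^ r / t) * (q / t ^ (r - 1) * #Q) := by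
  have hnn : ∀ C : Finset (Finset (Fin t)), 0 ≤ (q / (t : ℝ) ^ (r - 1)) ^ #C := fun C => by
    positivity
  calc
    _ ≤ ∑ C ∈ tightFamiliesMeeting r Q,
        ∑ e ∈ Q, if e ∈ C then (q / (t : ℝ) ^ (r - 1)) ^ #C else 0 := by
      refine sum_le_sum fun C hC => ?_
      obtain ⟨-, e, he⟩ := mem_filter.1 hC
      rw [mem_inter] at he
      rw [← sum_filter]
      exact single_le_sum (f := fun _ => (q / (t : ℝ) ^ (r - 1)) ^ #C) (fun _ _ => hnn C)
        (mem_filter.2 ⟨he.2, he.1⟩)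
    _ ≤ ∑ C ∈ tightFamilies r t, ∑ e ∈ Q, if e ∈ C then (q / (t : ℝ) ^ (r - 1)) ^ #C else 0 :=
      sum_le_sum_of_subset_of_nonneg (filter_subset _ _) fun C _ _ =>
        sum_nonneg fun e _ => ite_nonneg (hnn C) le_rfl
    _ = ∑ e ∈ Q, ∑ C ∈ (tightFamilies r t).filter (e ∈ ·), (q / (t : ℝ) ^ (r - 1)) ^ #C := by
      rw [sum_comm]
      simp only [sum_filter]
    _ ≤ ∑ e ∈ Q, r * 2 ^ 2 ^ (r + (r + 1) * (r - 1)) * (q / t ^ (r - 1)) * (q ^ r / t) :=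
      sum_le_sum fun e _ => sum_tightFamilies_filter_mem_le hr ht hq e
    _ = _ := by
      rw [sum_const, nsmul_eq_mul]
      ring

/-- Passing from `H` to `H \ ⋃ 𝒟` loses few members of `Q` if few members of `𝒟` meet `Q`. -/
lemma card_inter_le_card_sdiff_biUnion_inter_add {α : Type*} [DecidableEq α] (H Q : Finset α)
    (𝒟 : Finset (Finset α)) {m : ℕ} (hm : ∀ C ∈ 𝒟, #C ≤ m) :
    #(H ∩ Q) ≤ #((H \ 𝒟.biUnion id) ∩ Q) + #(𝒟.filter fun C => (C ∩ Q).Nonempty) * m := by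
  have hsub : H ∩ Q ⊆ ((H \ 𝒟.biUnion id) ∩ Q) ∪
      (𝒟.filter fun C => (C ∩ Q).Nonempty).biUnion id := by
    intro x hx
    rw [mem_inter] at hx
    by_cases h : x ∈ 𝒟.biUnion id
    · obtain ⟨C, hC, hxC⟩ := mem_biUnion.1 h
      exact mem_union_right _ (mem_biUnion.2
        ⟨C, mem_filter.2 ⟨hC, x, mem_inter.2 ⟨hxC, hx.2⟩⟩, hxC⟩)
    · exact mem_union_left _ (mem_inter.2 ⟨mem_sdiff.2 ⟨hx.1, h⟩, hx.2⟩)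
  refine (card_le_card hsub).trans ((card_union_le _ _).trans (Nat.add_le_add_left ?_ _))
  exact card_biUnion_le_card_mul _ _ _ fun C hC => hm C (mem_filter.1 hC).1

end Counting

section Estimates

open Finset Filter

lemma half_pow_le_factorial_mul_choose {s k : ℕ} (hs : 2 * k ≤ s) :
    ((s : ℝ) / 2) ^ k ≤ k.factorial * s.choose k := by
  have h₁ : (s + 1 - k) ^ k ≤ k.factorial * s.choose k := by
    rw [← Nat.descFactorial_eq_factorial_mul_choose]
    exact Nat.pow_sub_le_descFactorial s k
  have h₂ : (s : ℝ) / 2 ≤ ((s + 1 - k : ℕ) : ℝ) := by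
    have : s ≤ 2 * (s + 1 - k) := by omega
    have : (s : ℝ) ≤ 2 * ((s + 1 - k : ℕ) : ℝ) := by exact_mod_cast this
    linarith
  calc
    ((s : ℝ) / 2) ^ k ≤ ((s + 1 - k : ℕ) : ℝ) ^ k := by gcongr
    _ ≤ k.factorial * s.choose k := by exact_mod_cast h₁

lemma rpow_one_sub_add_eq_div {t r : ℕ} (hr : 2 ≤ r) (ht : 0 < t) (x : ℝ) :
    (t : ℝ) ^ ((1 : ℝ) - r + x) = (t : ℝ) ^ x / (t : ℝ) ^ (r - 1) := by
  have ht' : (0 : ℝ) < t := by exact_mod_cast ht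
  have hcast : ((r - 1 : ℕ) : ℝ) = (r : ℝ) - 1 := by
    rw [Nat.cast_sub (by omega), Nat.cast_one]
  rw [← Real.rpow_natCast, ← Real.rpow_sub ht', hcast]
  congr 1
  ring

/-- The expected number of crossing edges exceeds `min s (t - s)` by a power of `t`. -/
lemma min_mul_rpow_le_mean_crossing {r s t : ℕ} (hr : 2 ≤ r) (hs : 2 * r ≤ s) (hst : s < t)
    (hlarge : (t : ℝ) ^ ((1 : ℝ) - 1 / (5 * (r : ℝ) ^ 2)) < s) :
    ((min s (t - s) : ℕ) : ℝ) * (t : ℝ) ^ (3 / (10 * (r : ℝ))) ≤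
      2 ^ r * (r - 1).factorial * (s.choose (r - 1) * ((t : ℝ) - s) *
        ((t : ℝ) ^ (1 / (2 * (r : ℝ))) / (t : ℝ) ^ (r - 1))) := by
  have ht : (0 : ℝ) < t := by exact_mod_cast (by omega : 0 < t)
  have ht1 : (1 : ℝ) ≤ t := by exact_mod_cast (by omega : 1 ≤ t)
  have hst' : (s : ℝ) < t := by exact_mod_cast hst
  have hr' : (2 : ℝ) ≤ r := by exact_mod_cast hr
  have hchoose := half_pow_le_factorial_mul_choose (s := s) (k := r - 1) (by omega)
  obtain ⟨m, rfl⟩ : ∃ m, r = m + 2 := ⟨r - 2, by omega⟩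
  rw [show m + 2 - 1 = m + 1 by omega] at *
  set q : ℝ := (t : ℝ) ^ (1 / (2 * ((m + 2 : ℕ) : ℝ))) with hq
  have hratio : (t : ℝ) ^ (-(1 / (5 * ((m + 2 : ℕ) : ℝ)))) ≤ ((s : ℝ) / t) ^ m := by
    have h₁ : (t : ℝ) ^ (-(1 / (5 * ((m + 2 : ℕ) : ℝ) ^ 2))) ≤ (s : ℝ) / t := by
      rw [le_div_iff₀ ht, ← Real.rpow_add_one ht.ne']
      refine le_trans (le_of_eq ?_) hlarge.le
      congr 1
      ring
    refine le_trans ?_ (pow_le_pow_left₀ (by positivity) h₁ m)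
    rw [← Real.rpow_natCast, ← Real.rpow_mul ht.le]
    refine Real.rpow_le_rpow_of_exponent_le ht1 ?_
    rw [neg_mul, neg_le_neg_iff, div_mul_eq_mul_div, one_mul,
      div_le_div_iff₀ (by positivity) (by positivity)]
    push_cast
    nlinarith [(Nat.cast_nonneg m : (0 : ℝ) ≤ m)]
  have hexp : (t : ℝ) ^ (3 / (10 * ((m + 2 : ℕ) : ℝ))) =
      (t : ℝ) ^ (-(1 / (5 * ((m + 2 : ℕ) : ℝ)))) * q := by
    rw [hq, ← Real.rpow_add ht]
    congr 1
    field_simp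
    norm_num
  have hmin : ((min s (t - s) : ℕ) : ℝ) ≤ 2 * ((s : ℝ) * (t - s) / t) := by
    rw [← mul_div_assoc, le_div_iff₀ ht, Nat.cast_min, Nat.cast_sub hst.le]
    have hs₀ : (0 : ℝ) ≤ s := Nat.cast_nonneg s
    rcases le_total (s : ℝ) (t - s) with h | h
    · rw [min_eq_left h]
      nlinarith
    · rw [min_eq_right h]
      nlinarith
  have hq₀ : 0 ≤ q := by positivity
  have hst₀ : (0 : ℝ) ≤ t - s := by linarith
  calc
    _ ≤ 2 * ((s : ℝ) * (t - s) / t) * (((s : ℝ) / t) ^ m * q) := by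
      rw [hexp]
      gcongr
    _ = 2 ^ (m + 2) * (((s : ℝ) / 2) ^ (m + 1) * (((t : ℝ) - s) * (q / (t : ℝ) ^ (m + 1)))) := by
      rw [div_pow, div_pow]
      field_simp
      ring
    _ ≤ 2 ^ (m + 2) * (((m + 1).factorial * s.choose (m + 1)) *
        (((t : ℝ) - s) * (q / (t : ℝ) ^ (m + 1)))) := by
      gcongr
    _ = _ := by ring

/-- Failure weights decaying like `t ^ (-2 * min #S (t - #S))` have small total mass. -/
lemma sum_lt_one_of_le_exp_neg_min {t : ℕ} (ht : 10 ≤ t) (I : Finset (Finset (Fin t)))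
    (hI : ∀ S ∈ I, S.Nonempty ∧ #S < t) (f : Finset (Fin t) → ℝ)
    (hf : ∀ S ∈ I, f S ≤ 2 * Real.exp (-(((min #S (t - #S) : ℕ) : ℝ) * (2 * Real.log t)))) :
    ∑ S ∈ I, f S < 1 := by
  have ht' : (10 : ℝ) ≤ t := by exact_mod_cast ht
  have ht₀ : (0 : ℝ) < t := by linarith
  set x : ℝ := ((t : ℝ) ^ 2)⁻¹ with hx
  have hx₀ : 0 ≤ x := by positivity
  have hexp : ∀ m : ℕ, Real.exp (-((m : ℝ) * (2 * Real.log t))) = x ^ m := by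
    intro m
    rw [← mul_neg, Real.exp_nat_mul, Real.exp_neg, two_mul, Real.exp_add, Real.exp_log ht₀, hx, sq]
  have htotal : (1 + x) ^ t ≤ 10 / 9 := by
    have h₁ : (1 + x) ^ t ≤ Real.exp (1 / t) := by
      calc
        (1 + x) ^ t ≤ Real.exp x ^ t := by
          gcongr
          linarith [Real.add_one_le_exp x]
        _ = Real.exp (1 / t) := by
          rw [← Real.exp_nat_mul, hx]
          congr 1
          field_simp
    have h₂ := Real.add_one_le_exp (-(1 / (t : ℝ)))
    have h₃ : Real.exp (1 / t) * Real.exp (-(1 / (t : ℝ))) = 1 := by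
      rw [← Real.exp_add, add_neg_cancel, Real.exp_zero]
    have h₄ : 1 / (t : ℝ) ≤ 1 / 10 := one_div_le_one_div_of_le (by norm_num) ht'
    nlinarith [Real.exp_pos (1 / (t : ℝ))]
  have hleft : ∑ S ∈ I, x ^ #S ≤ 1 / 9 := by
    have h := Fintype.sum_pow_mul_eq_add_pow (Fin t) x 1
    simp only [one_pow, mul_one, Fintype.card_fin] at h
    rw [← add_sum_erase _ _ (mem_univ (∅ : Finset (Fin t))), card_empty, pow_zero,
      add_comm x 1] at h
    have hsub : ∑ S ∈ I, x ^ #S ≤ ∑ S ∈ univ.erase (∅ : Finset (Fin t)), x ^ #S :=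
      sum_le_sum_of_subset_of_nonneg
        (fun S hS => mem_erase.2 ⟨(hI S hS).1.ne_empty, mem_univ _⟩) fun _ _ _ => by positivity
    linarith
  have hright : ∑ S ∈ I, x ^ (t - #S) ≤ 1 / 9 := by
    have h := Fintype.sum_pow_mul_eq_add_pow (Fin t) 1 x
    simp only [one_pow, one_mul, Fintype.card_fin] at h
    rw [← add_sum_erase _ _ (mem_univ (univ : Finset (Fin t))), card_univ, Fintype.card_fin,
      Nat.sub_self, pow_zero] at h
    have hsub : ∑ S ∈ I, x ^ (t - #S) ≤ ∑ S ∈ univ.erase (univ : Finset (Fin t)), x ^ (t - #S) := by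
      refine sum_le_sum_of_subset_of_nonneg (fun S hS => mem_erase.2 ⟨?_, mem_univ _⟩)
        fun _ _ _ => by positivity
      rintro rfl
      simpa using (hI _ hS).2
    linarith
  calc
    ∑ S ∈ I, f S ≤ ∑ S ∈ I, 2 * (x ^ #S + x ^ (t - #S)) := by
      refine sum_le_sum fun S hS => (hf S hS).trans ?_
      rw [hexp]
      have h₁ : 0 ≤ x ^ #S := by positivity
      have h₂ : 0 ≤ x ^ (t - #S) := by positivity
      rcases min_choice #S (t - #S) with h | h <;> rw [h] <;> linarith
    _ = 2 * (∑ S ∈ I, x ^ #S + ∑ S ∈ I, x ^ (t - #S)) := by rw [← mul_sum, sum_add_distrib]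
    _ < 1 := by linarith

lemma eventually_le_rpow {y : ℝ} (hy : 0 < y) (c : ℝ) :
    ∀ᶠ t : ℕ in atTop, c ≤ (t : ℝ) ^ y :=
  ((tendsto_rpow_atTop hy).comp tendsto_natCast_atTop_atTop).eventually_ge_atTop c

lemma eventually_mul_log_le_rpow {y : ℝ} (hy : 0 < y) (c : ℝ) :
    ∀ᶠ t : ℕ in atTop, c * Real.log t ≤ (t : ℝ) ^ y := by
  have h := ((isLittleO_log_rpow_atTop hy).const_mul_left c).bound one_pos
  filter_upwards [tendsto_natCast_atTop_atTop.eventually h] with t ht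
  rw [one_mul, Real.norm_of_nonneg (Real.rpow_nonneg (Nat.cast_nonneg t) y)] at ht
  exact (le_abs_self _).trans ht

lemma eventually_mul_rpow_pow_div_le {r : ℕ} (hr : r ≠ 0) (c : ℝ) {ε : ℝ} (hε : 0 < ε) :
    ∀ᶠ t : ℕ in atTop, c * (((t : ℝ) ^ (1 / (2 * (r : ℝ)))) ^ r / t) ≤ ε := by
  filter_upwards [eventually_le_rpow (y := 1 / 2) (by norm_num) (c / ε), eventually_gt_atTop 0]
    with t ht ht₀
  have ht' : (0 : ℝ) < t := by exact_mod_cast ht₀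
  have hr' : (r : ℝ) ≠ 0 := by exact_mod_cast hr
  have hpow : ((t : ℝ) ^ (1 / (2 * (r : ℝ)))) ^ r = (t : ℝ) ^ (1 / 2 : ℝ) := by
    rw [← Real.rpow_natCast, ← Real.rpow_mul ht'.le]
    congr 1
    field_simp
  have hsq : (t : ℝ) = (t : ℝ) ^ (1 / 2 : ℝ) * (t : ℝ) ^ (1 / 2 : ℝ) := by
    rw [← Real.rpow_add ht']
    norm_num
  have hy : 0 < (t : ℝ) ^ (1 / 2 : ℝ) := Real.rpow_pos_of_pos ht' _
  rw [hpow]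
  nth_rw 2 [hsq]
  rw [div_mul_cancel_left₀ hy.ne', ← div_eq_mul_inv, div_le_iff₀ hy, mul_comm]
  exact (div_le_iff₀ hε).1 ht

end Estimates

open Finset in
/-- Alteration: a set of `r`-sets meeting every `Q S` often, with few disjoint tight families near
`Q S`, contains a tight-family-free subset still meeting every `Q S` often. -/
lemma exists_tightFamilies_free_subset {r t : ℕ} {ι : Type*} (I : Finset ι)
    (Q : ι → Finset (Finset (Fin t))) (X : ι → ℝ) (H : Finset (Finset (Fin t)))
    (hH : ∀ S ∈ I, X S / 5 < #(H ∩ Q S) ∧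
      ∀ 𝒟 ⊆ tightFamiliesMeeting r (Q S), (𝒟 : Set (Finset (Finset (Fin t)))).PairwiseDisjoint id →
        (∀ C ∈ 𝒟, C ⊆ H) → #𝒟 < 1 / (10 * ((r : ℝ) + 1)) * X S) :
    ∃ E ⊆ H, (∀ C ∈ tightFamilies r t, ¬ C ⊆ E) ∧ ∀ S ∈ I, X S / 10 ≤ #(E ∩ Q S) := by
  have htight : ∀ C ∈ tightFamilies r t, 2 ≤ #C ∧ #C ≤ r + 1 := fun C hC =>
    ⟨(mem_filter.1 hC).2.1, (mem_filter.1 hC).2.2.1⟩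
  obtain ⟨𝒟, h𝒟, hdisj, h𝒟H, hfree⟩ := exists_disjoint_subfamily_forall_not_subset_sdiff
    (tightFamilies r t) (fun C hC => card_pos.1 (by linarith [(htight C hC).1])) H
  refine ⟨H \ 𝒟.biUnion id, sdiff_subset, hfree, fun S hS => ?_⟩
  obtain ⟨hmany, hfew⟩ := hH S hS
  have hlt := hfew (𝒟.filter fun C => (C ∩ Q S).Nonempty) (filter_subset_filter _ h𝒟)
    (hdisj.subset (coe_subset.2 (filter_subset _ _))) fun C hC => h𝒟H C (mem_filter.1 hC).1
  have hloss := card_inter_le_card_sdiff_biUnion_inter_add H (Q S) 𝒟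
    fun C hC => (htight C (h𝒟 hC)).2
  have hloss' : (#(H ∩ Q S) : ℝ) ≤ #((H \ 𝒟.biUnion id) ∩ Q S) +
      #(𝒟.filter fun C => (C ∩ Q S).Nonempty) * ((r : ℝ) + 1) := by exact_mod_cast hloss
  have hr₀ : (0 : ℝ) < (r : ℝ) + 1 := by positivity
  have hmul := mul_lt_mul_of_pos_right hlt hr₀
  have heq : 1 / (10 * ((r : ℝ) + 1)) * X S * ((r : ℝ) + 1) = X S / 10 := by field_simp
  linarith

/-- For `r ≥ 2`, `δ = 1/(5r²)` and all sufficiently large `t`, there is an `r`-uniform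
hypergraph on `t` vertices of girth at least `r + 2` (no two edges share two vertices, and
no loose cycle of length `3 ≤ ℓ ≤ r+1`) such that for every vertex set `S` with
`t^{1-δ} < |S| < t`, the number of edges with exactly `r - 1` vertices in `S` is at least
`(1/10)·C(|S|, r-1)·(t-|S|)·t^{1-r+1/(2r)}`. -/
theorem stmt18 (r : ℕ) (hr : 2 ≤ r) :
    ∃ t₀ : ℕ, ∀ t : ℕ, t₀ ≤ t →
      ∃ E : Finset (Finset (Fin t)),
        (∀ e ∈ E, e.card = r) ∧
        (∀ e ∈ E, ∀ f ∈ E, e ≠ f → (e ∩ f).card ≤ 1) ∧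
        (∀ ℓ : ℕ, 3 ≤ ℓ → ℓ ≤ r + 1 →
          ¬ ∃ (e : ZMod ℓ → Finset (Fin t)) (v : ZMod ℓ → Fin t),
              IsLooseCycle E ℓ e v) ∧
        (∀ S : Finset (Fin t),
          (t : ℝ) ^ ((1 : ℝ) - 1/(5 * (r : ℝ) ^ 2)) < (S.card : ℝ) → S.card < t →
          (1/10 : ℝ) * (S.card.choose (r - 1) : ℝ) * ((t : ℝ) - S.card) *
              (t : ℝ) ^ ((1 : ℝ) - r + 1/(2 * (r : ℝ))) ≤
            ((E.filter fun e => (e ∩ S).card = r - 1).card : ℝ)) := by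
  have hr' : (2 : ℝ) ≤ r := by exact_mod_cast hr
  set c : ℝ := 1 / (10 * ((r : ℝ) + 1)) with hc
  have hc₀ : 0 < c := by positivity
  have hc₁ : c ≤ 1 / 10 := one_div_le_one_div_of_le (by norm_num) (by linarith)
  set B : ℝ := 2 ^ r * (r - 1).factorial with hB
  have hB₀ : 0 < B := by positivity
  have hδ : 0 < (1 : ℝ) - 1 / (5 * (r : ℝ) ^ 2) := by
    rw [sub_pos, div_lt_one (by positivity)]
    nlinarith
  refine Filter.eventually_atTop.1 ?_
  filter_upwards [Filter.eventually_ge_atTop 10, eventually_le_rpow hδ (2 * r),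
    eventually_mul_rpow_pow_div_le (r := r) (by omega)
      (Real.exp 1 * (r * 2 ^ 2 ^ (r + (r + 1) * (r - 1)))) (half_pos hc₀),
    eventually_mul_log_le_rpow (y := 3 / (10 * (r : ℝ))) (by positivity) (4 * B / c)]
    with t ht hlarge hμ hlog
  have ht₀ : 0 < t := by omega
  have ht₁ : (1 : ℝ) ≤ t := by exact_mod_cast ht₀
  have hpow := rpow_one_sub_add_eq_div hr ht₀ (1 / (2 * (r : ℝ)))
  set q : ℝ := (t : ℝ) ^ (1 / (2 * (r : ℝ))) with hq
  have hq₁ : 1 ≤ q := Real.one_le_rpow ht₁ (by positivity)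
  set p : ℝ := q / (t : ℝ) ^ (r - 1) with hp
  have hp₀ : 0 ≤ p := by positivity
  have hp₁ : p ≤ 1 := by
    rw [← hpow]
    refine Real.rpow_le_one_of_one_le_of_nonpos ht₁ ?_
    have : 1 / (2 * (r : ℝ)) ≤ 1 := (div_le_one (by positivity)).2 (by linarith)
    linarith
  set I : Finset (Finset (Fin t)) := Finset.univ.filter fun S =>
    (t : ℝ) ^ ((1 : ℝ) - 1 / (5 * (r : ℝ) ^ 2)) < (S.card : ℝ) ∧ S.card < t with hI
  have hI_card : ∀ S ∈ I, 2 * r ≤ S.card ∧ S.card < t := by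
    intro S hS
    obtain ⟨h₁, h₂⟩ := (Finset.mem_filter.1 hS).2
    exact ⟨by exact_mod_cast (hlarge.trans h₁.le), h₂⟩
  have hQ : ∀ S ∈ I, (S.card.choose (r - 1) : ℝ) * ((t : ℝ) - S.card) * p ≤
      p * (crossingSets r S).card := by
    intro S hS
    rw [mul_comm p]
    refine mul_le_mul_of_nonneg_right ?_ hp₀
    rw [← Nat.cast_sub (hI_card S hS).2.le]
    exact_mod_cast choose_mul_le_card_crossingSets hr S
  have hmean : ∀ S ∈ I, ((min S.card (t - S.card) : ℕ) : ℝ) * (2 * Real.log t) ≤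
      c / 2 * (p * (crossingSets r S).card) := by
    intro S hS
    have h₁ := min_mul_rpow_le_mean_crossing hr (hI_card S hS).1 (hI_card S hS).2
      (Finset.mem_filter.1 hS).2.1
    have h₂ := mul_le_mul_of_nonneg_left (hQ S hS) hB₀.le
    have h₃ := mul_le_mul_of_nonneg_left hlog
      (Nat.cast_nonneg (α := ℝ) (min S.card (t - S.card)))
    have h₄ := (h₃.trans h₁).trans h₂
    calc
      _ = c / 2 / B * (((min S.card (t - S.card) : ℕ) : ℝ) * (4 * B / c * Real.log t)) := by
        field_simp
        ring
      _ ≤ c / 2 / B * (B * (p * (crossingSets r S).card)) := by gcongr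
      _ = _ := by field_simp
  obtain ⟨H, hHR, hH⟩ := exists_subset_forall_inter_large_and_disjoint_small
    (R := Finset.powersetCard r Finset.univ) hp₀ hp₁ I (crossingSets r)
    (fun S _ => Finset.filter_subset _ _) (fun S => tightFamiliesMeeting r (crossingSets r S))
    (fun S _ C hC => Finset.mem_powerset.1
      (Finset.mem_filter.1 (Finset.mem_filter.1 hC).1).1)
    (fun S => p * (crossingSets r S).card / 5) (fun S => c * (p * (crossingSets r S).card)) (by
      refine sum_lt_one_of_le_exp_neg_min ht I (fun S hS =>
        ⟨Finset.card_pos.1 (by linarith [(hI_card S hS).1]), (hI_card S hS).2⟩) _ fun S hS => ?_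
      have hX := hmean S hS
      set X : ℝ := p * (crossingSets r S).card
      have hX₀ : 0 ≤ X := by positivity
      have hsum := mul_le_mul_of_nonneg_left
        (sum_tightFamiliesMeeting_le hr ht₀ hq₁ (crossingSets r S)) (Real.exp_pos 1).le
      have hsum' := mul_le_mul_of_nonneg_right hμ hX₀
      rw [two_mul (Real.exp _)]
      refine add_le_add (Real.exp_le_exp.2 ?_) (Real.exp_le_exp.2 ?_)
      · nlinarith
      · refine (sub_le_sub_right (hsum.trans (le_trans (le_of_eq ?_) hsum')) _).trans
          (b := c / 2 * X - c * X) ?_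
        · ring
        · linarith)
  obtain ⟨E, hEH, hfree, hE⟩ := exists_tightFamilies_free_subset I (crossingSets r)
    (fun S => p * (crossingSets r S).card) H hH
  have hEr : ∀ e ∈ E, e.card = r := fun e he =>
    (Finset.mem_powersetCard.1 (hHR (hEH he))).2
  refine ⟨E, hEr, card_inter_le_one_of_tightFamilies_free hr hEr hfree, ?_, fun S hS₁ hS₂ => ?_⟩
  · rintro ℓ hℓ hℓr ⟨e, v, hev⟩
    exact not_isLooseCycle_of_tightFamilies_free hEr hfree hℓ hℓr e v hev
  · have hS : S ∈ I := Finset.mem_filter.2 ⟨Finset.mem_univ _, hS₁, hS₂⟩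
    have hsub : E ∩ crossingSets r S ⊆ E.filter fun e => (e ∩ S).card = r - 1 := fun e he =>
      Finset.mem_filter.2 ⟨(Finset.mem_inter.1 he).1,
        (Finset.mem_filter.1 (Finset.mem_inter.1 he).2).2⟩
    have hcard : ((E ∩ crossingSets r S).card : ℝ) ≤
        ((E.filter fun e => (e ∩ S).card = r - 1).card : ℝ) := by
      exact_mod_cast Finset.card_le_card hsub
    rw [hpow]
    linarith [hE S hS, hQ S hS]
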